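/- Let s ∈ ℂ with Re(s) > −1/2 and for N ≥ 1 define P̃_N(x) = 2^{Re(s)} (Γ(2Re(s)+N+1)/(N·Γ(N)))^{1/2} · p̃_N(Nx) · √(w_H(Nx)) and Q_N(x) = 2^{Re(s)+1} (N·Γ(2Re(s)+N+1)/Γ(N))^{1/2} · p_{N−1}(Nx) · √(w_H(Nx)). Then P̃_N and Q_N are C^∞ on ℝ, P̃ and Q are C^∞ on ℝ∖{0}, and for every x ≠ 0 and every p ∈ ℕ: (Sgn(x))^N · P̃_N^{(p)}(x) → P̃^{(p)}(x) and (Sgn(x))^N · Q_N^{(p)}(x) → Q^{(p)}(x) as N → ∞. Moreover, for every p ∈ ℕ and every x₀ > 0 there is a constant C(x₀,s,p) such that |P̃_N^{(p)}(x)| ≤ C(x₀,s,p)/|x|^{p+Re(s)} and |Q_N^{(p)}(x)| ≤ C(x₀,s,p)/|x|^{p+1+Re(s)} for all N ≥ 1 and all |x| ≥ x₀. -/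

import Mathlib

noncomputable section

open Complex MeasureTheory Filter Set

/-- Rising Pochhammer symbol `(x)_n = x(x+1)⋯(x+n−1)`. -/
def poch (x : ℂ) (n : ℕ) : ℂ := ∏ i ∈ Finset.range n, (x + i)

/-- Confluent hypergeometric series `₁F₁[r, q; z]`. -/
def oneF1 (r q z : ℂ) : ℂ := ∑' n : ℕ, poch r n / (poch q n * n.factorial) * z ^ n

/-- Terminating Gauss hypergeometric series `₂F₁[−m, b, c; z]`. -/
def twoF1neg (m : ℕ) (b c z : ℂ) : ℂ :=
  ∑ k ∈ Finset.range (m + 1),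
    poch (-(m : ℂ)) k * poch b k / (poch c k * (k.factorial : ℂ)) * z ^ k

/-- The common prefactor `|2/x|^{Re s} e^{−i/x + π Im(s) Sgn(x)/2}`. -/
def prefac (s : ℂ) (x : ℝ) : ℂ :=
  ((|2 / x| ^ s.re : ℝ) : ℂ) *
    Complex.exp (-Complex.I / (x : ℂ) + ((Real.pi * s.im * Real.sign x / 2 : ℝ) : ℂ))

/-- `P̃(x) = |2/x|^{Re s} e^{−i/x + π Im(s) Sgn(x)/2} ₁F₁[s, 2Re(s)+1; 2i/x]`. -/
def Ptilde (s : ℂ) (x : ℝ) : ℂ :=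
  prefac s x * oneF1 s ((2 * s.re + 1 : ℝ) : ℂ) (2 * Complex.I / (x : ℂ))

/-- `Q(x) = (2/x)|2/x|^{Re s} e^{−i/x + π Im(s) Sgn(x)/2} ₁F₁[s+1, 2Re(s)+2; 2i/x]`. -/
def Qfun (s : ℂ) (x : ℝ) : ℂ :=
  (2 / (x : ℂ)) * prefac s x * oneF1 (s + 1) ((2 * s.re + 2 : ℝ) : ℂ) (2 * Complex.I / (x : ℂ))

/-- The constant in front of the limiting kernel `K_∞`. -/
def cinf (s : ℂ) : ℂ :=
  (1 / (2 * (Real.pi : ℂ))) *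
    (Complex.Gamma (s + 1) * Complex.Gamma ((starRingEnd ℂ) s + 1) /
      (Complex.Gamma ((2 * s.re + 1 : ℝ) : ℂ) * Complex.Gamma ((2 * s.re + 2 : ℝ) : ℂ)))

/-- The limiting kernel `K_∞`, as a complex number (it is in fact real). -/
def KinfC (s : ℂ) (x y : ℝ) : ℂ :=
  if x = y then cinf s * (deriv (Ptilde s) x * Qfun s x - deriv (Qfun s) x * Ptilde s x)
  else cinf s * (Ptilde s x * Qfun s y - Qfun s x * Ptilde s y) / ((x : ℂ) - (y : ℂ))

/-- The limiting kernel `K_∞` (real-valued). -/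
def Kinf (s : ℂ) (x y : ℝ) : ℝ := (KinfC s x y).re

/-- The generalized Cauchy weight `w_H` on `ℝ`. -/
def wH (s : ℂ) (N : ℕ) (x : ℝ) : ℝ :=
  (1 + x ^ 2) ^ (-s.re - (N : ℝ)) * Real.exp (2 * s.im * Complex.arg (1 + Complex.I * x))

/-- The polynomial `p_{N−1}`. -/
def pPrev (s : ℂ) (N : ℕ) (x : ℝ) : ℂ :=
  ((x : ℂ) - Complex.I) ^ (N - 1) *
    twoF1neg (N - 1) (s + 1) ((2 * s.re + 2 : ℝ) : ℂ) (2 / (1 + Complex.I * (x : ℂ)))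

/-- The polynomial `p̃_N`. -/
def pTil (s : ℂ) (N : ℕ) (x : ℝ) : ℂ :=
  ((x : ℂ) - Complex.I) ^ N *
    twoF1neg N s ((2 * s.re + 1 : ℝ) : ℂ) (2 / (1 + Complex.I * (x : ℂ)))

/-- The constant `C_{N,s}`. -/
def CNs (s : ℂ) (N : ℕ) : ℂ :=
  (((2 : ℝ) ^ (2 * s.re) / Real.pi : ℝ) : ℂ) *
    (Complex.Gamma ((2 * s.re + N + 1 : ℝ) : ℂ) * Complex.Gamma (s + 1) *
        Complex.Gamma ((starRingEnd ℂ) s + 1) /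
      (Complex.Gamma (N : ℂ) * Complex.Gamma ((2 * s.re + 1 : ℝ) : ℂ) *
        Complex.Gamma ((2 * s.re + 2 : ℝ) : ℂ)))

def phiN (s : ℂ) (N : ℕ) (x : ℝ) : ℂ := pTil s N x * (Real.sqrt (wH s N x) : ℂ)

def psiN (s : ℂ) (N : ℕ) (x : ℝ) : ℂ := pPrev s N x * (Real.sqrt (wH s N x) : ℂ)

/-- The finite-`N` kernel `K_N` (complex form; extended to the diagonal by continuity,
i.e. by the Bernoulli–l'Hôpital expression). -/
def KNC (s : ℂ) (N : ℕ) (x y : ℝ) : ℂ :=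
  if x = y then CNs s N * (deriv (phiN s N) x * psiN s N x - deriv (psiN s N) x * phiN s N x)
  else CNs s N * (phiN s N x * psiN s N y - psiN s N x * phiN s N y) / ((x : ℂ) - (y : ℂ))

/-- The finite-`N` kernel `K_N` (real-valued). -/
def KN (s : ℂ) (N : ℕ) (x y : ℝ) : ℝ := (KNC s N x y).re

/-- The rescaled kernel `K_[N](x,y) = N · K_N(Nx, Ny)`. -/
def Kscaled (s : ℂ) (N : ℕ) (x y : ℝ) : ℝ := N * KN s N (N * x) (N * y)

/-- `P̃_N`. -/
def PtildeN (s : ℂ) (N : ℕ) (x : ℝ) : ℂ :=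
  (((2 : ℝ) ^ s.re : ℝ) : ℂ) *
    (Real.sqrt (Real.Gamma (2 * s.re + N + 1) / (N * Real.Gamma N)) : ℂ) *
    pTil s N (N * x) * (Real.sqrt (wH s N (N * x)) : ℂ)

/-- `Q_N`. -/
def QN (s : ℂ) (N : ℕ) (x : ℝ) : ℂ :=
  (((2 : ℝ) ^ (s.re + 1) : ℝ) : ℂ) *
    (Real.sqrt (N * Real.Gamma (2 * s.re + N + 1) / Real.Gamma N) : ℂ) *
    pPrev s N (N * x) * (Real.sqrt (wH s N (N * x)) : ℂ)

/-- `k`-point correlation function of a kernel. -/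
def rhoK (K : ℝ → ℝ → ℝ) (k : ℕ) (x : Fin k → ℝ) : ℝ :=
  Matrix.det (Matrix.of fun i j => K (x i) (x j))

/-- The Fredholm determinant of a kernel restricted to `(t,∞)²`. -/
def fredholmDet (K : ℝ → ℝ → ℝ) (t : ℝ) : ℝ :=
  1 + ∑' k : ℕ, ((-1 : ℝ) ^ (k + 1) / (k + 1).factorial) *
    ∫ x : Fin (k + 1) → ℝ in Set.univ.pi fun _ => Set.Ioi t, rhoK K (k + 1) x

/-- Mixed partial derivative `∂^{p+q}K/∂x^p∂y^q`. -/
def pderiv₂ (K : ℝ → ℝ → ℝ) (p q : ℕ) (x y : ℝ) : ℝ :=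
  iteratedDeriv p (fun x' => iteratedDeriv q (fun y' => K x' y') y) x

/-- `F_{n,h,a}(x) = ₂F₁[−n, h, a; 2/(1+ix)]` (a terminating series). -/
def Fnha (n : ℕ) (h : ℂ) (a : ℝ) (x : ℝ) : ℂ :=
  ∑' k : ℕ, poch (-(n : ℂ)) k * poch h k / (poch (a : ℂ) k * (k.factorial : ℂ)) *
    (2 / (1 + Complex.I * (x : ℂ))) ^ k

/-- `θ(τ) = τ (d/dτ) log F(τ⁻¹)`. -/
def thetaOf (F : ℝ → ℝ) (τ : ℝ) : ℝ := τ * deriv (fun u => Real.log (F u⁻¹)) τ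

/-- Squared Vandermonde determinant `∏_{j<k} (x_j − x_k)²`. -/
def vandSq (N : ℕ) (x : Fin N → ℝ) : ℝ :=
  ∏ p ∈ Finset.univ.filter fun p : Fin N × Fin N => p.1 < p.2, (x p.1 - x p.2) ^ 2

/-- `φ(x,y) = (f(x)g(y) − g(x)f(y))/(x−y)`, extended to the diagonal. -/
def phiFG (f g : ℝ → ℝ) (x y : ℝ) : ℝ :=
  if x = y then deriv f x * g x - deriv g x * f x else (f x * g y - g x * f y) / (x - y)

/-- The functions satisfying
`(d/dx)^p (|x|^{-a} G(1/x)) = |x|^{-a} x^{-p} (invDeriv a G p)(1/x)`. -/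
def invDeriv (a : ℝ) (G : ℂ → ℂ) : ℕ → ℂ → ℂ
  | 0 => G
  | p + 1 => fun u => -((a + p : ℝ) : ℂ) * invDeriv a G p u - u * deriv (invDeriv a G p) u

theorem differentiableOn_invDeriv {U : Set ℂ} (hU : IsOpen U) (a : ℝ) {G : ℂ → ℂ}
    (hG : DifferentiableOn ℂ G U) (p : ℕ) : DifferentiableOn ℂ (invDeriv a G p) U := by
  induction p with
  | zero => exact hG
  | succ p ih => exact (ih.const_mul _).sub (differentiableOn_id.mul (ih.deriv hU))

/-- Locally uniform convergence on an open set follows from joint convergence. -/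
theorem tendstoLocallyUniformlyOn_of_tendsto_prod {U : Set ℂ} (hU : IsOpen U)
    {G : ℕ → ℂ → ℂ} {g : ℂ → ℂ}
    (h : ∀ u ∈ U, Tendsto (fun q : ℕ × ℂ => G q.1 q.2) (atTop ×ˢ nhds u) (nhds (g u))) :
    TendstoLocallyUniformlyOn G g atTop U := by
  have hpt : ∀ u ∈ U, Tendsto (fun N => G N u) atTop (nhds (g u)) := fun u hu =>
    (h u hu).comp (tendsto_id.prodMk (tendsto_const_nhds (x := u)))
  rw [tendstoLocallyUniformlyOn_iff_filter]
  intro u hu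
  have h1 : Tendsto (fun q : ℕ × ℂ => g q.2) (atTop ×ˢ nhds u) (nhds (g u)) := by
    suffices ContinuousAt g u from this.tendsto.comp tendsto_snd
    rw [Metric.continuousAt_iff']
    intro ε hε
    obtain ⟨pa, hpa, pb, hpb, hab⟩ :=
      eventually_prod_iff.mp (Metric.tendsto_nhds.mp (h u hu) (ε / 2) (half_pos hε))
    filter_upwards [hpb, hU.mem_nhds hu] with w hw hwU
    refine lt_of_le_of_lt (le_of_tendsto ((hpt w hwU).dist tendsto_const_nhds) ?_)
      (half_lt_self hε)
    filter_upwards [hpa] with N hN using (hab hN hw).le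
  rw [hU.nhdsWithin_eq hu, tendstoUniformlyOnFilter_iff_tendsto]
  exact (h1.prodMk_nhds (h u hu)).mono_right (nhds_le_uniformity _)

theorem TendstoLocallyUniformlyOn.tendsto_prod {U : Set ℂ} (hU : IsOpen U)
    {G : ℕ → ℂ → ℂ} {g : ℂ → ℂ} (h : TendstoLocallyUniformlyOn G g atTop U)
    (hg : ContinuousOn g U) {u : ℂ} (hu : u ∈ U) :
    Tendsto (fun q : ℕ × ℂ => G q.1 q.2) (atTop ×ˢ nhds u) (nhds (g u)) := by
  have h1 : Tendsto (fun q : ℕ × ℂ => g q.2) (atTop ×ˢ nhds u) (nhds (g u)) :=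
    ((hg.continuousAt (hU.mem_nhds hu)).tendsto).comp tendsto_snd
  have h2 := tendstoLocallyUniformlyOn_iff_filter.mp h u hu
  rw [hU.nhdsWithin_eq hu, tendstoUniformlyOnFilter_iff_tendsto] at h2
  exact h1.congr_uniformity h2

theorem tendstoLocallyUniformlyOn_invDeriv {U : Set ℂ} (hU : IsOpen U) (a : ℝ)
    {G : ℕ → ℂ → ℂ} {g : ℂ → ℂ} (hG : ∀ N, DifferentiableOn ℂ (G N) U)
    (h : TendstoLocallyUniformlyOn G g atTop U) (p : ℕ) :
    TendstoLocallyUniformlyOn (fun N => invDeriv a (G N) p) (invDeriv a g p) atTop U := by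
  have hg : DifferentiableOn ℂ g U := h.differentiableOn (Eventually.of_forall hG) hU
  induction p with
  | zero => exact h
  | succ p ih =>
    have hd := ih.deriv (Eventually.of_forall fun N => differentiableOn_invDeriv hU a (hG N) p) hU
    have hgp := differentiableOn_invDeriv hU a hg p
    refine tendstoLocallyUniformlyOn_of_tendsto_prod hU fun u hu => ?_
    exact ((ih.tendsto_prod hU hgp.continuousOn hu).const_mul _).sub
      (tendsto_snd.mul (hd.tendsto_prod hU (hgp.deriv hU).continuousOn hu))

theorem hasDerivAt_abs_rpow_neg (a : ℝ) {x : ℝ} (hx : x ≠ 0) :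
    HasDerivAt (fun x : ℝ => |x| ^ (-a)) (-a * |x| ^ (-a) * x⁻¹) x := by
  have h := (hasDerivAt_abs hx).rpow_const (p := -a) (Or.inl (abs_ne_zero.mpr hx))
  convert h using 1
  rw [Real.rpow_sub_one (abs_ne_zero.mpr hx)]
  rcases lt_or_gt_of_ne hx with h0 | h0
  · simp [abs_of_neg h0, sign_neg h0]; field_simp
  · simp [abs_of_pos h0, sign_pos h0]; field_simp

theorem iteratedDeriv_abs_rpow_mul_comp_inv {U : Set ℂ} (hU : IsOpen U)
    (hR : ∀ x : ℝ, (x : ℂ) ∈ U) (a : ℝ) {G : ℂ → ℂ} (hG : DifferentiableOn ℂ G U) (p : ℕ) :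
    ∀ x : ℝ, x ≠ 0 →
      iteratedDeriv p (fun x : ℝ => ((|x| ^ (-a) : ℝ) : ℂ) * G (x : ℂ)⁻¹) x =
        ((|x| ^ (-a) : ℝ) : ℂ) * ((x : ℂ)⁻¹) ^ p * invDeriv a G p (x : ℂ)⁻¹ := by
  induction p with
  | zero => intro x _; simp [invDeriv]
  | succ p ih =>
    intro x hx
    have hxc : (x : ℂ) ≠ 0 := by exact_mod_cast hx
    rw [iteratedDeriv_succ]
    have he : iteratedDeriv p (fun x : ℝ => ((|x| ^ (-a) : ℝ) : ℂ) * G (x : ℂ)⁻¹) =ᶠ[nhds x]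
        fun x : ℝ => ((|x| ^ (-a) : ℝ) : ℂ) * ((x : ℂ)⁻¹) ^ p * invDeriv a G p (x : ℂ)⁻¹ := by
      filter_upwards [isOpen_ne.mem_nhds hx] with y hy using ih y hy
    rw [he.deriv_eq]
    have hmem : (x : ℂ)⁻¹ ∈ U := by rw [← Complex.ofReal_inv]; exact hR _
    have h1 : HasDerivAt (fun x : ℝ => ((|x| ^ (-a) : ℝ) : ℂ))
        ((-a * |x| ^ (-a) * x⁻¹ : ℝ) : ℂ) x := (hasDerivAt_abs_rpow_neg a hx).ofReal_comp
    have h2 : HasDerivAt (fun x : ℝ => (x : ℂ)⁻¹) (-((x : ℂ) ^ 2)⁻¹) x :=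
      (hasDerivAt_inv hxc).comp_ofReal
    have h3 : HasDerivAt (invDeriv a G p) (deriv (invDeriv a G p) (x : ℂ)⁻¹) (x : ℂ)⁻¹ :=
      ((differentiableOn_invDeriv hU a hG p).differentiableAt (hU.mem_nhds hmem)).hasDerivAt
    have h4 := (h1.mul (h2.pow p)).mul (h3.comp x h2)
    refine h4.deriv.trans ?_
    simp only [invDeriv, Function.comp_def, Pi.mul_apply, Pi.pow_apply]
    push_cast
    rw [← inv_pow]
    generalize (x : ℂ)⁻¹ = w
    rcases p with _ | p
    · simp; ring
    · simp only [Nat.add_sub_cancel]; push_cast; ring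

/-- Transfer from locally uniform convergence of holomorphic functions in the variable `1/x`
to convergence of, and bounds on, all derivatives in the variable `x`. -/
theorem derivatives_converge_of_comp_inv {U : Set ℂ} (hU : IsOpen U)
    (hR : ∀ x : ℝ, (x : ℂ) ∈ U) (a : ℝ) (A : ℝ → ℂ)
    {G : ℕ → ℂ → ℂ} {g : ℂ → ℂ} (hG : ∀ N, DifferentiableOn ℂ (G N) U)
    (h : TendstoLocallyUniformlyOn G g atTop U) {f : ℕ → ℝ → ℂ} {φ : ℝ → ℂ}
    (hf : ∀ N, 1 ≤ N → ∀ x : ℝ, x ≠ 0 → f N x = ((Real.sign x : ℝ) : ℂ) ^ N * A (Real.sign x) *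
      (((|x| ^ (-a) : ℝ) : ℂ) * G N (x : ℂ)⁻¹))
    (hφ : ∀ x : ℝ, x ≠ 0 → φ x = A (Real.sign x) * (((|x| ^ (-a) : ℝ) : ℂ) * g (x : ℂ)⁻¹)) :
    ContDiffOn ℝ (⊤ : ℕ∞) φ {0}ᶜ ∧
    (∀ x : ℝ, x ≠ 0 → ∀ p : ℕ, Tendsto
      (fun N : ℕ => ((Real.sign x : ℝ) : ℂ) ^ N * iteratedDeriv p (f N) x)
      atTop (nhds (iteratedDeriv p φ x))) ∧
    ∀ p : ℕ, ∀ x₀ : ℝ, 0 < x₀ → ∃ C : ℝ, ∀ N : ℕ, 1 ≤ N → ∀ x : ℝ, x₀ ≤ |x| →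
      ‖iteratedDeriv p (f N) x‖ ≤ C / |x| ^ ((p : ℝ) + a) := by
  have hg : DifferentiableOn ℂ g U := h.differentiableOn (Eventually.of_forall hG) hU
  have hinv : ∀ x : ℝ, (x : ℂ)⁻¹ ∈ U := fun x => by rw [← Complex.ofReal_inv]; exact hR _
  have hsign : ∀ x : ℝ, x ≠ 0 → ∀ᶠ y in nhds x, y ≠ 0 ∧ Real.sign y = Real.sign x := by
    intro x hx
    rcases lt_or_gt_of_ne hx with h0 | h0
    · filter_upwards [isOpen_Iio.mem_nhds h0] with y hy
      exact ⟨ne_of_lt hy, by rw [Real.sign_of_neg h0, Real.sign_of_neg hy]⟩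
    · filter_upwards [isOpen_Ioi.mem_nhds h0] with y hy
      exact ⟨ne_of_gt hy, by rw [Real.sign_of_pos h0, Real.sign_of_pos hy]⟩
  have hsq : ∀ x : ℝ, x ≠ 0 → ((Real.sign x : ℝ) : ℂ) * ((Real.sign x : ℝ) : ℂ) = 1 := by
    intro x hx
    rcases Real.sign_apply_eq_of_ne_zero x hx with h0 | h0 <;> simp [h0]
  have hfd : ∀ N, 1 ≤ N → ∀ x : ℝ, x ≠ 0 → ∀ p : ℕ, iteratedDeriv p (f N) x =
      ((Real.sign x : ℝ) : ℂ) ^ N * A (Real.sign x) *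
      (((|x| ^ (-a) : ℝ) : ℂ) * ((x : ℂ)⁻¹) ^ p * invDeriv a (G N) p (x : ℂ)⁻¹) := by
    intro N hN x hx p
    have he : f N =ᶠ[nhds x] fun y => (((Real.sign x : ℝ) : ℂ) ^ N * A (Real.sign x)) *
        (((|y| ^ (-a) : ℝ) : ℂ) * G N (y : ℂ)⁻¹) := by
      filter_upwards [hsign x hx] with y hy
      rw [hf N hN y hy.1, hy.2]
    rw [he.iteratedDeriv_eq, iteratedDeriv_const_mul_field,
      iteratedDeriv_abs_rpow_mul_comp_inv hU hR a (hG N) p x hx]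
  have hφe : ∀ x : ℝ, x ≠ 0 → φ =ᶠ[nhds x] fun y => A (Real.sign x) *
      (((|y| ^ (-a) : ℝ) : ℂ) * g (y : ℂ)⁻¹) := by
    intro x hx
    filter_upwards [hsign x hx] with y hy
    rw [hφ y hy.1, hy.2]
  refine ⟨?_, ?_, ?_⟩
  · intro x hx
    have hx0 : x ≠ 0 := hx
    have hxc : (x : ℂ) ≠ 0 := by exact_mod_cast hx0
    refine ContDiffAt.contDiffWithinAt ?_
    refine ContDiffAt.congr_of_eventuallyEq ?_ (hφe x hx0)
    have h1 : ContDiffAt ℝ (⊤ : ℕ∞) (fun y : ℝ => |y| ^ (-a)) x :=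
      (contDiffAt_abs hx0).rpow_const_of_ne (abs_ne_zero.mpr hx0)
    have h2 : ContDiffAt ℝ (⊤ : ℕ∞) (fun y : ℝ => (y : ℂ)⁻¹) x :=
      ContDiffAt.inv (Complex.ofRealCLM.contDiff.contDiffAt) hxc
    have h3 : ContDiffAt ℝ (⊤ : ℕ∞) g (x : ℂ)⁻¹ :=
      ((hg.contDiffOn hU).contDiffAt (hU.mem_nhds (hinv x))).restrict_scalars ℝ
    have h4 : ContDiffAt ℝ (⊤ : ℕ∞) (fun y : ℝ => ((|y| ^ (-a) : ℝ) : ℂ)) x :=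
      Complex.ofRealCLM.contDiff.contDiffAt.comp x h1
    exact contDiffAt_const.mul (h4.mul (h3.comp x h2))
  · intro x hx p
    rw [(hφe x hx).iteratedDeriv_eq, iteratedDeriv_const_mul_field,
      iteratedDeriv_abs_rpow_mul_comp_inv hU hR a hg p x hx]
    have h1 := (tendstoLocallyUniformlyOn_invDeriv hU a hG h p).tendsto_at (hinv x)
    refine ((h1.const_mul (((|x| ^ (-a) : ℝ) : ℂ) * ((x : ℂ)⁻¹) ^ p)).const_mul
      (A (Real.sign x))).congr' ?_
    filter_upwards [eventually_ge_atTop 1] with N hN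
    rw [hfd N hN x hx p, ← mul_assoc (((Real.sign x : ℝ) : ℂ) ^ N),
      ← mul_assoc (((Real.sign x : ℝ) : ℂ) ^ N), ← mul_pow, hsq x hx, one_pow, one_mul]
  · intro p x₀ hx₀
    set K : Set ℂ := Set.image Complex.ofReal (Set.Icc (-x₀⁻¹) x₀⁻¹) with hKdef
    have hK : IsCompact K := isCompact_Icc.image Complex.continuous_ofReal
    have hKU : K ⊆ U := by rintro _ ⟨x, -, rfl⟩; exact hR x
    have hlim := tendstoLocallyUniformlyOn_invDeriv hU a hG h p
    have hunif := (tendstoLocallyUniformlyOn_iff_forall_isCompact hU).mp hlim K hKU hK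
    obtain ⟨B, hB⟩ := hK.exists_bound_of_continuousOn
      ((differentiableOn_invDeriv hU a hg p).continuousOn.mono hKU)
    obtain ⟨M, hM⟩ := eventually_atTop.mp (Metric.tendstoUniformlyOn_iff.mp hunif 1 one_pos)
    choose b hb using fun N => hK.exists_bound_of_continuousOn
      ((differentiableOn_invDeriv hU a (hG N) p).continuousOn.mono hKU)
    have hD : ∃ D : ℝ, 0 ≤ D ∧ ∀ N, ∀ u ∈ K, ‖invDeriv a (G N) p u‖ ≤ D := by
      refine ⟨|B| + 1 + ∑ N ∈ Finset.range M, |b N|, by positivity, fun N u hu => ?_⟩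
      have hs : 0 ≤ ∑ N ∈ Finset.range M, |b N| := Finset.sum_nonneg fun _ _ => abs_nonneg _
      rcases lt_or_ge N M with hN | hN
      · have h1 := Finset.single_le_sum (f := fun N => |b N|) (fun _ _ => abs_nonneg _)
          (Finset.mem_range.mpr hN)
        have h2 := (hb N u hu).trans (le_abs_self _)
        have h3 := abs_nonneg B
        linarith
      · have h1 := hM N hN u hu
        rw [dist_comm, dist_eq_norm] at h1
        have h2 := norm_le_norm_add_norm_sub' (invDeriv a (G N) p u) (invDeriv a g p u)
        have h3 := (hB u hu).trans (le_abs_self _)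
        linarith
    obtain ⟨D, hD0, hD⟩ := hD
    refine ⟨(‖A 1‖ + ‖A (-1)‖) * D, fun N hN x hx => ?_⟩
    have hxp : 0 < |x| := hx₀.trans_le hx
    have hx0 : x ≠ 0 := abs_pos.mp hxp
    have hu : (x : ℂ)⁻¹ ∈ K := by
      refine ⟨x⁻¹, ?_, by simp⟩
      rw [Set.mem_Icc, ← abs_le, abs_inv]
      exact inv_anti₀ hx₀ hx
    have hA : ‖((Real.sign x : ℝ) : ℂ) ^ N * A (Real.sign x)‖ ≤ ‖A 1‖ + ‖A (-1)‖ := by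
      rcases Real.sign_apply_eq_of_ne_zero x hx0 with h0 | h0 <;> simp [h0]
    rw [hfd N hN x hx0 p, norm_mul, norm_mul (_ * _ ^ p), norm_mul (((|x| ^ (-a) : ℝ) : ℂ)),
      norm_pow, norm_inv, Complex.norm_real, Complex.norm_real, Real.norm_eq_abs,
      Real.norm_eq_abs, abs_of_pos (Real.rpow_pos_of_pos hxp _)]
    have h5 : |x| ^ (-a) * |x|⁻¹ ^ p = (|x| ^ ((p : ℝ) + a))⁻¹ := by
      rw [Real.rpow_add hxp, Real.rpow_natCast, Real.rpow_neg hxp.le, mul_inv, inv_pow, mul_comm]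
    rw [h5, div_eq_mul_inv, mul_comm (|x| ^ ((p : ℝ) + a))⁻¹, ← mul_assoc]
    have := hD N _ hu
    gcongr

/-- The strip `|Im u| < 1/2`. -/
def halfStrip : Set ℂ := {u | |u.im| < 1 / 2}

theorem isOpen_halfStrip : IsOpen halfStrip :=
  isOpen_lt (continuous_abs.comp Complex.continuous_im) continuous_const

theorem ofReal_mem_halfStrip (x : ℝ) : (x : ℂ) ∈ halfStrip := by
  simp [halfStrip]

theorem div_natCast_mem_halfStrip {u : ℂ} (hu : u ∈ halfStrip) (N : ℕ) :
    u / (N : ℂ) ∈ halfStrip := by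
  simp only [halfStrip, Set.mem_ofPred_eq, Complex.div_natCast_im] at hu ⊢
  rcases Nat.eq_zero_or_pos N with rfl | hN
  · simp
  · have h1 : (1 : ℝ) ≤ N := by exact_mod_cast hN
    rw [abs_div, Nat.abs_cast]
    exact (div_le_self (abs_nonneg _) h1).trans_lt hu

theorem one_add_I_mul_mem_slitPlane {v : ℂ} (hv : v ∈ halfStrip) :
    1 + Complex.I * v ∈ Complex.slitPlane := by
  left
  have := (abs_lt.mp (show |v.im| < 1 / 2 from hv)).2
  simp; linarith

theorem one_sub_I_mul_mem_slitPlane {v : ℂ} (hv : v ∈ halfStrip) :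
    1 - Complex.I * v ∈ Complex.slitPlane := by
  left
  have := (abs_lt.mp (show |v.im| < 1 / 2 from hv)).1
  simp; linarith

theorem half_le_norm_add_I {v : ℂ} (hv : v ∈ halfStrip) : 1 / 2 ≤ ‖v + Complex.I‖ := by
  have := (abs_lt.mp (show |v.im| < 1 / 2 from hv)).1
  refine le_trans ?_ (Complex.abs_im_le_norm _)
  refine le_trans ?_ (le_abs_self _)
  simp; linarith

theorem add_I_ne_zero {v : ℂ} (hv : v ∈ halfStrip) : v + Complex.I ≠ 0 := by
  rw [← norm_pos_iff]
  linarith [half_le_norm_add_I hv]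

/-- The exponential part of `P̃_N` and `Q_N` in the variable `u = 1/x`. -/
def expFactor (s : ℂ) (N : ℕ) (u : ℂ) : ℂ :=
  Complex.exp ((N : ℂ) / 2 * (Complex.log (1 - Complex.I * (u / N)) -
      Complex.log (1 + Complex.I * (u / N))) -
    (starRingEnd ℂ) s / 2 * Complex.log (1 + Complex.I * (u / N)) -
    s / 2 * Complex.log (1 - Complex.I * (u / N)))

theorem differentiableOn_expFactor (s : ℂ) (N : ℕ) :
    DifferentiableOn ℂ (expFactor s N) halfStrip := by
  intro u hu
  have h1 := one_add_I_mul_mem_slitPlane (div_natCast_mem_halfStrip hu N)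
  have h2 := one_sub_I_mul_mem_slitPlane (div_natCast_mem_halfStrip hu N)
  unfold expFactor
  refine DifferentiableAt.differentiableWithinAt ?_
  fun_prop (disch := assumption)

theorem tendsto_snd_div_natCast (u : ℂ) :
    Tendsto (fun q : ℕ × ℂ => q.2 / (q.1 : ℂ)) (atTop ×ˢ nhds u) (nhds 0) := by
  have h1 : Tendsto (fun q : ℕ × ℂ => ((q.1 : ℂ))⁻¹) (atTop ×ˢ nhds u) (nhds 0) :=
    (tendsto_inv_atTop_nhds_zero_nat (𝕜 := ℂ)).comp tendsto_fst
  simpa [div_eq_mul_inv] using tendsto_snd.mul h1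

theorem tendsto_log_one_add_mul (c u : ℂ) :
    Tendsto (fun q : ℕ × ℂ => Complex.log (1 + c * (q.2 / q.1))) (atTop ×ˢ nhds u) (nhds 0) := by
  have h : Tendsto (fun q : ℕ × ℂ => 1 + c * (q.2 / q.1)) (atTop ×ˢ nhds u) (nhds 1) := by
    simpa using ((tendsto_snd_div_natCast u).const_mul c).const_add 1
  simpa using h.clog Complex.one_mem_slitPlane

theorem tendsto_mul_log_one_add_mul (c u : ℂ) :
    Tendsto (fun q : ℕ × ℂ => (q.1 : ℂ) * Complex.log (1 + c * (q.2 / q.1)))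
      (atTop ×ˢ nhds u) (nhds (c * u)) := by
  have h : Tendsto (fun q : ℕ × ℂ => 1 + c * (q.2 / q.1)) (atTop ×ˢ nhds u) (nhds 1) := by
    simpa using ((tendsto_snd_div_natCast u).const_mul c).const_add 1
  have hd := Complex.hasDerivAt_log Complex.one_mem_slitPlane
  have hds : Tendsto (fun q : ℕ × ℂ => dslope Complex.log 1 (1 + c * (q.2 / q.1)))
      (atTop ×ˢ nhds u) (nhds 1) := by
    have h1 := (continuousAt_dslope_same.mpr hd.differentiableAt).tendsto.comp h
    simpa [Function.comp_def, dslope_same, hd.deriv] using h1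
  have h2 : Tendsto (fun q : ℕ × ℂ => c * q.2 * dslope Complex.log 1 (1 + c * (q.2 / q.1)))
      (atTop ×ˢ nhds u) (nhds (c * u)) := by
    simpa using (tendsto_snd.const_mul c).mul hds
  refine h2.congr' ?_
  filter_upwards [tendsto_fst.eventually (eventually_ge_atTop 1)] with q hq
  have hN : (q.1 : ℂ) ≠ 0 := by exact_mod_cast (Nat.pos_iff_ne_zero.mp hq)
  have h3 := sub_smul_dslope Complex.log 1 (1 + c * (q.2 / q.1))
  simp only [add_sub_cancel_left, smul_eq_mul, Complex.log_one, sub_zero] at h3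
  rw [← h3]
  field_simp

theorem tendsto_expFactor (s u : ℂ) :
    Tendsto (fun q : ℕ × ℂ => expFactor s q.1 q.2) (atTop ×ˢ nhds u)
      (nhds (Complex.exp (-Complex.I * u))) := by
  have h1 := tendsto_mul_log_one_add_mul (-Complex.I) u
  have h2 := tendsto_mul_log_one_add_mul Complex.I u
  have h3 := (tendsto_log_one_add_mul Complex.I u).const_mul ((starRingEnd ℂ) s / 2)
  have h4 := (tendsto_log_one_add_mul (-Complex.I) u).const_mul (s / 2)
  have h5 := ((((h1.sub h2).const_mul (1 / 2)).sub h3).sub h4).cexp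
  convert h5 using 2
  · simp only [expFactor]
    congr 1
    ring_nf
  · ring_nf

theorem twoF1neg_eq_tsum (m : ℕ) (b c z : ℂ) :
    twoF1neg m b c z = ∑' k : ℕ,
      poch (-(m : ℂ)) k * poch b k / (poch c k * (k.factorial : ℂ)) * z ^ k := by
  refine (tsum_eq_sum fun k hk => ?_).symm
  have : poch (-(m : ℂ)) k = 0 :=
    Finset.prod_eq_zero (i := m) (by simp at hk ⊢; omega) (by simp)
  simp [this]

theorem norm_poch_neg_natCast_le {m N : ℕ} (h : m ≤ N) (k : ℕ) :
    ‖poch (-(m : ℂ)) k‖ ≤ (N : ℝ) ^ k := by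
  rcases lt_or_ge m k with hk | hk
  · have : poch (-(m : ℂ)) k = 0 :=
      Finset.prod_eq_zero (i := m) (by simpa using hk) (by simp)
    rw [this, norm_zero]; positivity
  · rw [poch, norm_prod]
    calc ∏ i ∈ Finset.range k, ‖-(m : ℂ) + i‖ ≤ ∏ _i ∈ Finset.range k, (N : ℝ) := by
          refine Finset.prod_le_prod (fun _ _ => norm_nonneg _) fun i hi => ?_
          have hi' : i ≤ m := (Finset.mem_range.mp hi).le.trans hk
          have : -(m : ℂ) + i = -((m - i : ℕ) : ℂ) := by push_cast [hi']; ring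
          rw [this, norm_neg, Complex.norm_natCast]
          exact_mod_cast (Nat.sub_le m i).trans h
      _ = (N : ℝ) ^ k := by simp

theorem norm_poch_le (b : ℂ) {c : ℝ} (hc : 0 < c) (k : ℕ) :
    ‖poch b k‖ ≤ (‖b‖ / c + 1) ^ k * ‖poch (c : ℂ) k‖ := by
  rw [poch, poch, norm_prod, norm_prod, ← Finset.card_range k, ← Finset.prod_const,
    Finset.card_range, ← Finset.prod_mul_distrib]
  refine Finset.prod_le_prod (fun _ _ => norm_nonneg _) fun i _ => ?_
  have h1 : ‖(c : ℂ) + i‖ = c + i := by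
    rw [← Complex.ofReal_natCast, ← Complex.ofReal_add, Complex.norm_real, Real.norm_eq_abs,
      abs_of_nonneg (by positivity)]
  have h2 : ‖b + i‖ ≤ ‖b‖ + i := (norm_add_le _ _).trans (by simp)
  rw [h1]
  have h3 : (‖b‖ / c + 1) * (c + i) = ‖b‖ + i + c + ‖b‖ / c * i := by field_simp; ring
  rw [h3]
  have : 0 ≤ ‖b‖ / c * i := by positivity
  linarith

theorem poch_ofReal_ne_zero {c : ℝ} (hc : 0 < c) (k : ℕ) : poch (c : ℂ) k ≠ 0 := by
  refine Finset.prod_ne_zero_iff.mpr fun i _ => ?_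
  have : c + i ≠ 0 := by positivity
  exact_mod_cast this

/-- The hypergeometric part of `P̃_N` and `Q_N` in the variable `u = 1/x`. -/
def hypFactor (m : ℕ) (b c : ℂ) (N : ℕ) (u : ℂ) : ℂ :=
  twoF1neg m b c (2 * (u / N) / (u / N + Complex.I))

theorem differentiableOn_hypFactor (m : ℕ) (b c : ℂ) (N : ℕ) :
    DifferentiableOn ℂ (hypFactor m b c N) halfStrip := by
  intro u hu
  have h1 := add_I_ne_zero (div_natCast_mem_halfStrip hu N)
  unfold hypFactor twoF1neg
  refine DifferentiableAt.differentiableWithinAt ?_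
  refine DifferentiableAt.fun_sum fun k _ => ?_
  fun_prop (disch := assumption)

theorem tendsto_hypFactor (b : ℂ) {c : ℝ} (hc : 0 < c) {m : ℕ → ℕ} (hm : ∀ N, m N ≤ N)
    (hm' : Tendsto (fun N => (m N : ℂ) / N) atTop (nhds 1)) {u : ℂ} (hu : u ∈ halfStrip) :
    Tendsto (fun q : ℕ × ℂ => hypFactor (m q.1) b c q.1 q.2) (atTop ×ˢ nhds u)
      (nhds (oneF1 b c (2 * Complex.I * u))) := by
  simp only [hypFactor, twoF1neg_eq_tsum, oneF1]
  refine tendsto_tsum_of_dominated_convergence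
    (bound := fun k => (4 * (‖u‖ + 1) * (‖b‖ / c + 1)) ^ k / (k.factorial : ℝ))
    (Real.summable_pow_div_factorial _) (fun k => ?_) ?_
  · have hfac : ∀ i : ℕ, Tendsto
        (fun q : ℕ × ℂ => (-(m q.1 : ℂ) + i) * (2 * (q.2 / q.1) / (q.2 / q.1 + Complex.I)))
        (atTop ×ˢ nhds u) (nhds (2 * Complex.I * u)) := by
      intro i
      have h1 : Tendsto (fun q : ℕ × ℂ => -((m q.1 : ℂ) / q.1) + (i : ℂ) * (q.1 : ℂ)⁻¹)
          (atTop ×ˢ nhds u) (nhds (-1 + i * 0)) :=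
        (hm'.neg.add ((tendsto_inv_atTop_nhds_zero_nat (𝕜 := ℂ)).const_mul _)).comp tendsto_fst
      have h2 : Tendsto (fun q : ℕ × ℂ => 2 * q.2 / (q.2 / q.1 + Complex.I))
          (atTop ×ˢ nhds u) (nhds (2 * u / (0 + Complex.I))) :=
        (tendsto_snd.const_mul 2).div ((tendsto_snd_div_natCast u).add_const _) (by simp)
      have h3 := h1.mul h2
      have h4 : (-1 + (i : ℂ) * 0) * (2 * u / (0 + Complex.I)) = 2 * Complex.I * u := by
        rw [zero_add, mul_zero, add_zero, div_eq_mul_inv, Complex.inv_I]; ring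
      rw [h4] at h3
      refine h3.congr' ?_
      filter_upwards [tendsto_fst.eventually (eventually_ge_atTop 1)] with q hq
      have hN : (q.1 : ℂ) ≠ 0 := by exact_mod_cast (Nat.pos_iff_ne_zero.mp hq)
      field_simp
    have h5 := (tendsto_finsetProd (Finset.range k) fun i _ => hfac i).const_mul
      (poch b k / (poch c k * (k.factorial : ℂ)))
    simp only [Finset.prod_mul_distrib, Finset.prod_const, Finset.card_range] at h5
    convert h5 using 2 with q
    · simp only [poch]; ring
    · rw [mul_pow, mul_pow]
  · have hR : ∀ᶠ w in nhds u, ‖w‖ < ‖u‖ + 1 :=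
      continuous_norm.continuousAt.eventually_lt_const (by simp)
    filter_upwards [tendsto_fst.eventually (eventually_ge_atTop 1), tendsto_snd.eventually hR,
      tendsto_snd.eventually (isOpen_halfStrip.mem_nhds hu)] with q hq hqR hqU k
    have hN : (0 : ℝ) < q.1 := by exact_mod_cast hq
    have hv := half_le_norm_add_I (div_natCast_mem_halfStrip hqU q.1)
    have hz : ‖2 * (q.2 / (q.1 : ℂ)) / (q.2 / q.1 + Complex.I)‖ ≤ 4 * (‖u‖ + 1) / q.1 := by
      rw [norm_div, norm_mul, norm_div, Complex.norm_natCast, Complex.norm_ofNat,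
        div_le_iff₀ (by linarith)]
      calc 2 * (‖q.2‖ / q.1) ≤ 2 * ((‖u‖ + 1) / q.1) := by gcongr
        _ = 4 * (‖u‖ + 1) / q.1 * (1 / 2) := by ring
        _ ≤ _ := by gcongr
    have hp : 0 < ‖poch (c : ℂ) k‖ := norm_pos_iff.mpr (poch_ofReal_ne_zero hc k)
    rw [norm_mul, norm_div, norm_mul, norm_mul, norm_pow, Complex.norm_natCast]
    have hf : (0 : ℝ) < k.factorial := by positivity
    calc ‖poch (-(m q.1 : ℂ)) k‖ * ‖poch b k‖ / (‖poch (c : ℂ) k‖ * k.factorial) *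
          ‖2 * (q.2 / (q.1 : ℂ)) / (q.2 / q.1 + Complex.I)‖ ^ k
        ≤ (q.1 : ℝ) ^ k * ((‖b‖ / c + 1) ^ k * ‖poch (c : ℂ) k‖) /
          (‖poch (c : ℂ) k‖ * k.factorial) * (4 * (‖u‖ + 1) / q.1) ^ k := by
          gcongr
          · exact norm_poch_neg_natCast_le (hm _) k
          · exact norm_poch_le b hc k
      _ = _ := by
          generalize ‖b‖ / c + 1 = K
          generalize 4 * (‖u‖ + 1) = X
          rw [div_pow, mul_pow]
          field_simp

/-- The normalised Gamma ratio. -/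
def gammaFactor (a : ℝ) (N : ℕ) : ℝ :=
  Real.sqrt (Real.Gamma (2 * a + N + 1) / (N * Real.Gamma N)) * (N : ℝ) ^ (-a)

theorem Real.Gamma_add_natCast {t : ℝ} (ht : 0 < t) (n : ℕ) :
    Real.Gamma (t + n) = (∏ j ∈ Finset.range n, (t + j)) * Real.Gamma t := by
  induction n with
  | zero => simp
  | succ n ih =>
    rw [Finset.prod_range_succ, Nat.cast_succ, ← add_assoc, Real.Gamma_add_one (by positivity), ih]
    ring

theorem tendsto_gammaFactor {a : ℝ} (ha : -(1 / 2) < a) :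
    Tendsto (gammaFactor a) atTop (nhds 1) := by
  have ht : 0 < 2 * a + 1 := by linarith
  have hG := Real.Gamma_pos_of_pos ht
  have h1 : Tendsto (fun N : ℕ => Real.Gamma (2 * a + 1) / Real.GammaSeq (2 * a + 1) N)
      atTop (nhds 1) := by
    have := (tendsto_const_nhds (x := Real.Gamma (2 * a + 1))).div
      (Real.GammaSeq_tendsto_Gamma (2 * a + 1)) hG.ne'
    rwa [div_self hG.ne'] at this
  have h2 : Tendsto (fun N : ℕ => (N : ℝ) / (N + (2 * a + 1))) atTop (nhds 1) :=
    tendsto_natCast_div_add_atTop (2 * a + 1)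
  have h3 := (h1.mul h2).sqrt
  rw [mul_one, Real.sqrt_one] at h3
  refine h3.congr' ?_
  filter_upwards [eventually_ge_atTop 1] with N hN
  have hN0 : (0 : ℝ) < N := by exact_mod_cast hN
  have h4 : (N : ℝ) * Real.Gamma N = N.factorial := by
    rw [← Real.Gamma_add_one hN0.ne', Real.Gamma_nat_eq_factorial]
  have h5 : (N : ℝ) ^ (-a) = Real.sqrt ((N : ℝ) ^ (-(2 * a))) := by
    rw [Real.sqrt_eq_rpow, ← Real.rpow_mul hN0.le]; congr 1; ring
  have h6 : 2 * a + N + 1 = (2 * a + 1) + N := by ring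
  have hP : 0 < ∏ j ∈ Finset.range N, (2 * a + 1 + (j : ℝ)) :=
    Finset.prod_pos fun j _ => by positivity
  rw [gammaFactor, h5, ← Real.sqrt_mul' _ (by positivity), h4, h6, Real.Gamma_add_natCast ht]
  congr 1
  rw [Real.GammaSeq, Finset.prod_range_succ, Real.rpow_add hN0, Real.rpow_one, Real.rpow_neg hN0.le]
  have hr : 0 < (N : ℝ) ^ (2 * a) := by positivity
  have : 0 < (N : ℝ) + (2 * a + 1) := by positivity
  have : 0 < (2 * a + 1) + (N : ℝ) := by positivity
  have : 0 < (N.factorial : ℝ) := by positivity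
  field_simp
  ring

theorem arg_one_add_I_mul (y : ℝ) : Complex.arg (1 + Complex.I * y) = Real.arctan y := by
  rw [Complex.arg_of_re_nonneg (by simp), Real.arctan_eq_arcsin]
  congr 1
  have : ‖1 + Complex.I * (y : ℂ)‖ = Real.sqrt (1 + y ^ 2) := by
    rw [Complex.norm_eq_sqrt_sq_add_sq]; simp
  rw [this]; simp

theorem log_one_add_I_mul (v : ℝ) : Complex.log (1 + Complex.I * v) =
    ((Real.log (1 + v ^ 2) / 2 : ℝ) : ℂ) + (Real.arctan v : ℂ) * Complex.I := by
  have : ‖1 + Complex.I * (v : ℂ)‖ = Real.sqrt (1 + v ^ 2) := by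
    rw [Complex.norm_eq_sqrt_sq_add_sq]; simp
  rw [Complex.log, this, arg_one_add_I_mul, Real.log_sqrt (by positivity)]

theorem log_one_sub_I_mul (v : ℝ) : Complex.log (1 - Complex.I * v) =
    ((Real.log (1 + v ^ 2) / 2 : ℝ) : ℂ) - (Real.arctan v : ℂ) * Complex.I := by
  have h : 1 - Complex.I * (v : ℂ) = 1 + Complex.I * ((-v : ℝ) : ℂ) := by push_cast; ring
  rw [h, log_one_add_I_mul, neg_sq, Real.arctan_neg]
  push_cast; ring

theorem arctan_eq_sign_mul_sub {y : ℝ} (hy : y ≠ 0) :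
    Real.arctan y = Real.sign y * (Real.pi / 2) - Real.arctan y⁻¹ := by
  rcases lt_or_gt_of_ne hy with h | h
  · rw [Real.arctan_inv_of_neg h, Real.sign_of_neg h]; ring
  · rw [Real.arctan_inv_of_pos h, Real.sign_of_pos h]; ring

theorem sqrt_wH_eq (s : ℂ) (N : ℕ) {y : ℝ} (hy : y ≠ 0) :
    Real.sqrt (wH s N y) = |y| ^ (-s.re) * (|y| ^ N)⁻¹ *
      Real.exp (-(s.re + N) / 2 * Real.log (1 + y⁻¹ ^ 2) +
        s.im * (Real.sign y * (Real.pi / 2) - Real.arctan y⁻¹)) := by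
  have hy' : 0 < |y| := abs_pos.mpr hy
  have h1 : 1 + y ^ 2 = |y| ^ 2 * (1 + y⁻¹ ^ 2) := by
    rw [sq_abs]; field_simp; ring
  rw [wH, arg_one_add_I_mul, arctan_eq_sign_mul_sub hy,
    ← Real.exp_log (show 0 < 1 + y ^ 2 by positivity),
    ← Real.exp_mul, ← Real.exp_add, ← Real.exp_half, h1,
    Real.log_mul (by positivity) (by positivity), Real.log_pow,
    ← Real.rpow_natCast |y| N, ← Real.rpow_neg hy'.le, ← Real.rpow_add hy',
    Real.rpow_def_of_pos hy', ← Real.exp_add]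
  congr 1
  push_cast
  ring

theorem pow_mul_sqrt_wH_eq (s : ℂ) {N : ℕ} (hN : 1 ≤ N) {x : ℝ} (hx : x ≠ 0) :
    (((N * x : ℝ) : ℂ) - Complex.I) ^ N * (Real.sqrt (wH s N (N * x)) : ℂ) =
      ((Real.sign x : ℝ) : ℂ) ^ N * (Real.exp (s.im * (Real.sign x * (Real.pi / 2))) : ℂ) *
        (((N : ℝ) ^ (-s.re) * |x| ^ (-s.re) : ℝ) : ℂ) * expFactor s N (x : ℂ)⁻¹ := by
  have hN0 : (0 : ℝ) < N := by exact_mod_cast hN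
  have hNc : (N : ℂ) ≠ 0 := by exact_mod_cast hN0.ne'
  have hxc : (x : ℂ) ≠ 0 := by exact_mod_cast hx
  have hx' : 0 < |x| := abs_pos.mpr hx
  set y : ℝ := N * x with hy
  have hy0 : y ≠ 0 := mul_ne_zero hN0.ne' hx
  have hsy : Real.sign y = Real.sign x := by
    rcases lt_or_gt_of_ne hx with h | h
    · rw [Real.sign_of_neg h, Real.sign_of_neg (mul_neg_of_pos_of_neg hN0 h)]
    · rw [Real.sign_of_pos h, Real.sign_of_pos (mul_pos hN0 h)]
  have hay : |y| = N * |x| := by rw [hy, abs_mul, Nat.abs_cast]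
  have hyabs : y = Real.sign x * |y| := by
    rw [← hsy]
    rcases lt_or_gt_of_ne hy0 with h | h
    · rw [Real.sign_of_neg h, abs_of_neg h]; ring
    · rw [Real.sign_of_pos h, abs_of_pos h]; ring
  have hyc : (y : ℂ) ≠ 0 := by exact_mod_cast hy0
  have hv : (x : ℂ)⁻¹ / (N : ℂ) = ((y⁻¹ : ℝ) : ℂ) := by
    rw [hy]; push_cast; field_simp
  have hsub : (y : ℂ) - Complex.I =
      ((Real.sign x : ℝ) : ℂ) * ((|y| : ℝ) : ℂ) *
        Complex.exp (Complex.log (1 - Complex.I * ((y⁻¹ : ℝ) : ℂ))) := by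
    rw [Complex.exp_log (Complex.slitPlane_ne_zero
      (one_sub_I_mul_mem_slitPlane (ofReal_mem_halfStrip _))), ← Complex.ofReal_mul, ← hyabs]
    push_cast; field_simp
  have hya : ((|y| : ℝ) : ℂ) ≠ 0 := by exact_mod_cast (abs_pos.mpr hy0).ne'
  have hconj : (starRingEnd ℂ) s = (s.re : ℂ) - s.im * Complex.I := by
    apply Complex.ext <;> simp
  rw [sqrt_wH_eq s N hy0, hsy, hsub, expFactor, hv, log_one_add_I_mul, log_one_sub_I_mul, mul_pow,
    mul_pow, ← Complex.exp_nat_mul, hay, Real.mul_rpow hN0.le hx'.le, ← hay, hconj]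
  have hs2 : s / 2 = ((s.re : ℂ) + s.im * Complex.I) / 2 := by
    rw [Complex.re_add_im]
  rw [hs2]
  generalize Real.log (1 + y⁻¹ ^ 2) = L
  generalize Real.arctan y⁻¹ = t
  have hexp : Complex.exp ((N : ℂ) * (((L / 2 : ℝ) : ℂ) - (t : ℂ) * Complex.I)) *
      (Real.exp (-(s.re + N) / 2 * L + s.im * (Real.sign x * (Real.pi / 2) - t)) : ℂ) =
      (Real.exp (s.im * (Real.sign x * (Real.pi / 2))) : ℂ) *
      Complex.exp ((N : ℂ) / 2 * (((L / 2 : ℝ) : ℂ) - (t : ℂ) * Complex.I -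
        (((L / 2 : ℝ) : ℂ) + (t : ℂ) * Complex.I)) -
        ((s.re : ℂ) - s.im * Complex.I) / 2 * (((L / 2 : ℝ) : ℂ) + (t : ℂ) * Complex.I) -
        ((s.re : ℂ) + s.im * Complex.I) / 2 * (((L / 2 : ℝ) : ℂ) - (t : ℂ) * Complex.I)) := by
    rw [Complex.ofReal_exp, Complex.ofReal_exp, ← Complex.exp_add, ← Complex.exp_add]
    congr 1
    push_cast
    linear_combination (-(s.im : ℂ) * t) * Complex.I_sq
  have hpow : ((|y| : ℝ) : ℂ) ^ N * ((((|y| : ℝ) : ℂ)) ^ N)⁻¹ = 1 :=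
    mul_inv_cancel₀ (pow_ne_zero _ hya)
  push_cast at hexp hpow ⊢
  linear_combination ((Real.sign x : ℝ) : ℂ) ^ N *
    (((N : ℝ) ^ (-s.re) : ℝ) : ℂ) * ((|x| ^ (-s.re) : ℝ) : ℂ) * hexp +
    ((Real.sign x : ℝ) : ℂ) ^ N * (((N : ℝ) ^ (-s.re) : ℝ) : ℂ) * ((|x| ^ (-s.re) : ℝ) : ℂ) *
    Complex.exp ((N : ℂ) * ((L : ℂ) / 2 - (t : ℂ) * Complex.I)) *
    Complex.exp (-((s.re : ℂ) + N) / 2 * L + s.im * ((Real.sign x : ℝ) * (Real.pi / 2) - t)) * hpow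

theorem two_div_one_add_I_mul {N : ℕ} (hN : 1 ≤ N) {x : ℝ} (hx : x ≠ 0) :
    2 / (1 + Complex.I * ((N * x : ℝ) : ℂ)) =
      2 * ((x : ℂ)⁻¹ / N) / ((x : ℂ)⁻¹ / N + Complex.I) := by
  have hNc : (N : ℂ) ≠ 0 := by exact_mod_cast (Nat.pos_iff_ne_zero.mp hN)
  have hxc : (x : ℂ) ≠ 0 := by exact_mod_cast hx
  have h1 : (x : ℂ)⁻¹ / N + Complex.I ≠ 0 := by
    apply add_I_ne_zero
    apply div_natCast_mem_halfStrip
    rw [← Complex.ofReal_inv]; exact ofReal_mem_halfStrip _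
  have h2 : (x : ℂ)⁻¹ / N + Complex.I = (1 + Complex.I * ((N * x : ℝ) : ℂ)) / (N * x) := by
    push_cast; field_simp
  have h3 : 1 + Complex.I * ((N * x : ℝ) : ℂ) ≠ 0 := fun h => h1 (by rw [h2, h, zero_div])
  rw [h2]
  field_simp

theorem PtildeN_eq (s : ℂ) {N : ℕ} (hN : 1 ≤ N) {x : ℝ} (hx : x ≠ 0) :
    PtildeN s N x = ((Real.sign x : ℝ) : ℂ) ^ N *
      (((2 : ℝ) ^ s.re * Real.exp (s.im * (Real.sign x * (Real.pi / 2))) : ℝ) : ℂ) *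
      (((|x| ^ (-s.re) : ℝ) : ℂ) * ((gammaFactor s.re N : ℂ) * expFactor s N (x : ℂ)⁻¹ *
        hypFactor N s ((2 * s.re + 1 : ℝ) : ℂ) N (x : ℂ)⁻¹)) := by
  have h := pow_mul_sqrt_wH_eq s hN hx
  rw [PtildeN, pTil, two_div_one_add_I_mul hN hx, hypFactor, gammaFactor]
  push_cast at h ⊢
  linear_combination ((2 : ℝ) ^ s.re : ℝ) *
    (Real.sqrt (Real.Gamma (2 * s.re + N + 1) / (N * Real.Gamma N)) : ℂ) *
    twoF1neg N s (2 * s.re + 1) (2 * ((x : ℂ)⁻¹ / N) / ((x : ℂ)⁻¹ / N + Complex.I)) * h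

theorem inv_eq_sign_mul_inv_abs (x : ℝ) : x⁻¹ = Real.sign x * |x|⁻¹ := by
  rcases lt_trichotomy x 0 with h | rfl | h
  · rw [Real.sign_of_neg h, abs_of_neg h, inv_neg]; ring
  · simp
  · rw [Real.sign_of_pos h, abs_of_pos h]; ring

theorem QN_eq (s : ℂ) {N : ℕ} (hN : 1 ≤ N) {x : ℝ} (hx : x ≠ 0) :
    QN s N x = ((Real.sign x : ℝ) : ℂ) ^ N *
      (((2 : ℝ) ^ (s.re + 1) * Real.sign x *
        Real.exp (s.im * (Real.sign x * (Real.pi / 2))) : ℝ) : ℂ) *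
      (((|x| ^ (-(s.re + 1)) : ℝ) : ℂ) * ((gammaFactor s.re N : ℂ) *
        (1 - Complex.I * ((x : ℂ)⁻¹ / N))⁻¹ * expFactor s N (x : ℂ)⁻¹ *
        hypFactor (N - 1) (s + 1) ((2 * s.re + 2 : ℝ) : ℂ) N (x : ℂ)⁻¹)) := by
  have hN0 : (0 : ℝ) < N := by exact_mod_cast hN
  have hNc : (N : ℂ) ≠ 0 := by exact_mod_cast hN0.ne'
  have hxc : (x : ℂ) ≠ 0 := by exact_mod_cast hx
  have hx' : 0 < |x| := abs_pos.mpr hx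
  have h := pow_mul_sqrt_wH_eq s hN hx
  have hsub : ((N * x : ℝ) : ℂ) - Complex.I = N * x * (1 - Complex.I * ((x : ℂ)⁻¹ / N)) := by
    push_cast; field_simp
  have hne : 1 - Complex.I * ((x : ℂ)⁻¹ / N) ≠ 0 := by
    apply Complex.slitPlane_ne_zero
    apply one_sub_I_mul_mem_slitPlane
    apply div_natCast_mem_halfStrip
    rw [← Complex.ofReal_inv]; exact ofReal_mem_halfStrip _
  have hpow : (((N * x : ℝ) : ℂ) - Complex.I) ^ N =
      (((N * x : ℝ) : ℂ) - Complex.I) ^ (N - 1) * (N * x * (1 - Complex.I * ((x : ℂ)⁻¹ / N))) := by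
    rw [← hsub, ← pow_succ, Nat.sub_add_cancel hN]
  have hsqrt : Real.sqrt (N * Real.Gamma (2 * s.re + N + 1) / Real.Gamma N) =
      N * Real.sqrt (Real.Gamma (2 * s.re + N + 1) / (N * Real.Gamma N)) := by
    rw [← Real.sqrt_sq hN0.le, ← Real.sqrt_mul (by positivity), Real.sqrt_sq hN0.le]
    congr 1
    field_simp
  have hab : ((|x| ^ (-(s.re + 1)) : ℝ) : ℂ) * ((Real.sign x : ℝ) : ℂ) =
      ((|x| ^ (-s.re) : ℝ) : ℂ) * (x : ℂ)⁻¹ := by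
    rw [← Complex.ofReal_inv, inv_eq_sign_mul_inv_abs, neg_add, Real.rpow_add hx',
      Real.rpow_neg_one]
    push_cast; ring
  rw [hpow] at h
  rw [QN, pPrev, two_div_one_add_I_mul hN hx, hypFactor, gammaFactor, hsqrt]
  have h' : (((N * x : ℝ) : ℂ) - Complex.I) ^ (N - 1) * (Real.sqrt (wH s N (N * x)) : ℂ) * N =
      ((Real.sign x : ℝ) : ℂ) ^ N * (Real.exp (s.im * (Real.sign x * (Real.pi / 2))) : ℂ) *
        (((N : ℝ) ^ (-s.re) * |x| ^ (-s.re) : ℝ) : ℂ) * expFactor s N (x : ℂ)⁻¹ *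
        (x : ℂ)⁻¹ * (1 - Complex.I * ((x : ℂ)⁻¹ / N))⁻¹ := by
    rw [← h]
    generalize (1 - Complex.I * ((x : ℂ)⁻¹ / N)) = w at hne
    field_simp
  push_cast at h' hab ⊢
  generalize twoF1neg (N - 1) (s + 1) (2 * (s.re : ℂ) + 2)
    (2 * ((x : ℂ)⁻¹ / N) / ((x : ℂ)⁻¹ / N + Complex.I)) = F
  linear_combination ((2 : ℝ) ^ (s.re + 1) : ℝ) *
    (Real.sqrt (Real.Gamma (2 * s.re + N + 1) / (N * Real.Gamma N)) : ℂ) * F * h' -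
    ((Real.sign x : ℝ) : ℂ) ^ N * ((2 : ℝ) ^ (s.re + 1) : ℝ) *
    Complex.exp (s.im * ((Real.sign x : ℝ) * (Real.pi / 2))) *
    (Real.sqrt (Real.Gamma (2 * s.re + N + 1) / (N * Real.Gamma N)) : ℂ) * F *
    ((N : ℝ) ^ (-s.re) : ℝ) * expFactor s N (x : ℂ)⁻¹ *
    (1 - Complex.I * ((x : ℂ)⁻¹ / N))⁻¹ * hab

theorem prefac_eq (s : ℂ) {x : ℝ} (hx : x ≠ 0) :
    prefac s x =
      (((2 : ℝ) ^ s.re * Real.exp (s.im * (Real.sign x * (Real.pi / 2))) : ℝ) : ℂ) *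
      (((|x| ^ (-s.re) : ℝ) : ℂ) * Complex.exp (-Complex.I * (x : ℂ)⁻¹)) := by
  have hx' : 0 < |x| := abs_pos.mpr hx
  have h1 : |2 / x| ^ s.re = 2 ^ s.re * |x| ^ (-s.re) := by
    rw [abs_div, abs_two, Real.div_rpow zero_le_two hx'.le, Real.rpow_neg hx'.le, div_eq_mul_inv]
  have h2 : Real.pi * s.im * Real.sign x / 2 = s.im * (Real.sign x * (Real.pi / 2)) := by ring
  rw [prefac, h1, h2, Complex.exp_add, div_eq_mul_inv]
  push_cast
  ring

theorem Ptilde_eq (s : ℂ) {x : ℝ} (hx : x ≠ 0) :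
    Ptilde s x =
      (((2 : ℝ) ^ s.re * Real.exp (s.im * (Real.sign x * (Real.pi / 2))) : ℝ) : ℂ) *
      (((|x| ^ (-s.re) : ℝ) : ℂ) * (Complex.exp (-Complex.I * (x : ℂ)⁻¹) *
        oneF1 s ((2 * s.re + 1 : ℝ) : ℂ) (2 * Complex.I * (x : ℂ)⁻¹))) := by
  rw [Ptilde, prefac_eq s hx, div_eq_mul_inv (2 * Complex.I)]
  ring

theorem Qfun_eq (s : ℂ) {x : ℝ} (hx : x ≠ 0) :
    Qfun s x =
      (((2 : ℝ) ^ (s.re + 1) * Real.sign x *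
        Real.exp (s.im * (Real.sign x * (Real.pi / 2))) : ℝ) : ℂ) *
      (((|x| ^ (-(s.re + 1)) : ℝ) : ℂ) * (Complex.exp (-Complex.I * (x : ℂ)⁻¹) *
        oneF1 (s + 1) ((2 * s.re + 2 : ℝ) : ℂ) (2 * Complex.I * (x : ℂ)⁻¹))) := by
  have hx' : 0 < |x| := abs_pos.mpr hx
  have hinv : (x : ℂ)⁻¹ = ((Real.sign x : ℝ) : ℂ) * ((|x|⁻¹ : ℝ) : ℂ) := by
    rw [← Complex.ofReal_inv, inv_eq_sign_mul_inv_abs, Complex.ofReal_mul]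
  rw [Qfun, prefac_eq s hx, div_eq_mul_inv (2 : ℂ), div_eq_mul_inv (2 * Complex.I), neg_add,
    Real.rpow_add hx', Real.rpow_add two_pos, Real.rpow_neg_one, Real.rpow_one]
  generalize oneF1 _ _ _ = F
  generalize Complex.exp (-Complex.I * _) = E
  rw [hinv]
  push_cast
  ring

theorem contDiff_sqrt_wH (s : ℂ) (N : ℕ) :
    ContDiff ℝ (⊤ : ℕ∞) (fun x : ℝ => (Real.sqrt (wH s N (N * x)) : ℂ)) := by
  refine Complex.ofRealCLM.contDiff.comp (ContDiff.sqrt ?_ fun x => ?_)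
  · unfold wH
    simp only [arg_one_add_I_mul]
    refine ContDiff.mul (ContDiff.rpow_const_of_ne (by fun_prop) fun x => by positivity) ?_
    exact (contDiff_const.mul (Real.contDiff_arctan.comp (contDiff_const.mul contDiff_id))).exp
  · unfold wH
    positivity

theorem contDiff_ofReal_mul (r : ℝ) : ContDiff ℝ (⊤ : ℕ∞) (fun x : ℝ => ((r * x : ℝ) : ℂ)) :=
  Complex.ofRealCLM.contDiff.comp (contDiff_const.mul contDiff_id)

theorem contDiff_twoF1neg (m N : ℕ) (b c : ℂ) :
    ContDiff ℝ (⊤ : ℕ∞)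
      (fun x : ℝ => twoF1neg m b c (2 / (1 + Complex.I * ((N * x : ℝ) : ℂ)))) := by
  unfold twoF1neg
  refine ContDiff.sum fun k _ => contDiff_const.mul (ContDiff.pow ?_ k)
  have h : ContDiff ℝ (⊤ : ℕ∞) (fun x : ℝ => 1 + Complex.I * ((N * x : ℝ) : ℂ)) :=
    contDiff_const.add (contDiff_const.mul (contDiff_ofReal_mul N))
  simp only [div_eq_mul_inv]
  refine contDiff_const.mul (h.inv fun x => ?_)
  exact Complex.slitPlane_ne_zero (one_add_I_mul_mem_slitPlane (ofReal_mem_halfStrip _))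

theorem contDiff_sub_I_pow (m N : ℕ) :
    ContDiff ℝ (⊤ : ℕ∞) (fun x : ℝ => (((N * x : ℝ) : ℂ) - Complex.I) ^ m) :=
  ((contDiff_ofReal_mul N).sub contDiff_const).pow m

/-- For `Re(s) > −1/2`, the functions `P̃_N, Q_N` are `C^∞` on `ℝ`, `P̃, Q`
are `C^∞` on `ℝ∖{0}`, `Sgn(x)^N P̃_N^{(p)}(x) → P̃^{(p)}(x)` and
`Sgn(x)^N Q_N^{(p)}(x) → Q^{(p)}(x)` for every `x ≠ 0` and `p`, and for `|x| ≥ x₀ > 0`,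
`|P̃_N^{(p)}(x)| ≤ C(x₀,s,p)/|x|^{p+Re(s)}` and `|Q_N^{(p)}(x)| ≤ C(x₀,s,p)/|x|^{p+1+Re(s)}`. -/
theorem PtildeN_QN_derivatives_converge (s : ℂ) (hs : -(1 / 2 : ℝ) < s.re) :
    (∀ N : ℕ, 1 ≤ N → ContDiff ℝ (⊤ : ℕ∞) (PtildeN s N) ∧ ContDiff ℝ (⊤ : ℕ∞) (QN s N)) ∧
    ContDiffOn ℝ (⊤ : ℕ∞) (Ptilde s) {0}ᶜ ∧ ContDiffOn ℝ (⊤ : ℕ∞) (Qfun s) {0}ᶜ ∧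
    (∀ x : ℝ, x ≠ 0 → ∀ p : ℕ,
      Filter.Tendsto
        (fun N : ℕ => ((Real.sign x : ℝ) : ℂ) ^ N * iteratedDeriv p (PtildeN s N) x)
        Filter.atTop (nhds (iteratedDeriv p (Ptilde s) x)) ∧
      Filter.Tendsto
        (fun N : ℕ => ((Real.sign x : ℝ) : ℂ) ^ N * iteratedDeriv p (QN s N) x)
        Filter.atTop (nhds (iteratedDeriv p (Qfun s) x))) ∧
    ∀ p : ℕ, ∀ x₀ : ℝ, 0 < x₀ → ∃ C : ℝ, ∀ N : ℕ, 1 ≤ N → ∀ x : ℝ, x₀ ≤ |x| →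
      ‖iteratedDeriv p (PtildeN s N) x‖ ≤ C / |x| ^ ((p : ℝ) + s.re) ∧
      ‖iteratedDeriv p (QN s N) x‖ ≤ C / |x| ^ ((p : ℝ) + 1 + s.re) := by
  have hU := isOpen_halfStrip
  have hR := ofReal_mem_halfStrip
  have hγ := fun u : ℂ => ((Complex.continuous_ofReal.tendsto 1).comp
    (tendsto_gammaFactor hs)).comp (tendsto_fst (f := atTop) (g := nhds u))
  have hself : Tendsto (fun N : ℕ => (N : ℂ) / N) atTop (nhds 1) :=
    tendsto_const_nhds.congr' (by
      filter_upwards [eventually_ne_atTop 0] with N hN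
      rw [div_self (by exact_mod_cast hN)])
  have hpred : Tendsto (fun N : ℕ => ((N - 1 : ℕ) : ℂ) / N) atTop (nhds 1) := by
    have h := hself.sub (tendsto_inv_atTop_nhds_zero_nat (𝕜 := ℂ))
    rw [sub_zero] at h
    refine h.congr' ?_
    filter_upwards [eventually_ge_atTop 1] with N hN
    push_cast [hN]
    ring
  obtain ⟨hP1, hP2, hP3⟩ := derivatives_converge_of_comp_inv hU hR s.re
    (fun σ => (((2 : ℝ) ^ s.re * Real.exp (s.im * (σ * (Real.pi / 2))) : ℝ) : ℂ))
    (G := fun N u => (gammaFactor s.re N : ℂ) * expFactor s N u *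
      hypFactor N s ((2 * s.re + 1 : ℝ) : ℂ) N u)
    (g := fun u => Complex.exp (-Complex.I * u) *
      oneF1 s ((2 * s.re + 1 : ℝ) : ℂ) (2 * Complex.I * u))
    (fun N => ((differentiableOn_expFactor s N).const_mul _).mul
      (differentiableOn_hypFactor N _ _ N))
    (tendstoLocallyUniformlyOn_of_tendsto_prod hU fun u hu => by
      have h := ((hγ u).mul (tendsto_expFactor s u)).mul
        (tendsto_hypFactor s (c := 2 * s.re + 1) (by linarith) (m := id) (fun _ => le_rfl) hself hu)
      rw [Complex.ofReal_one, one_mul] at h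
      exact h)
    (f := PtildeN s) (φ := Ptilde s) (fun N hN x hx => PtildeN_eq s hN hx)
    (fun x hx => Ptilde_eq s hx)
  obtain ⟨hQ1, hQ2, hQ3⟩ := derivatives_converge_of_comp_inv hU hR (s.re + 1)
    (fun σ => (((2 : ℝ) ^ (s.re + 1) * σ * Real.exp (s.im * (σ * (Real.pi / 2))) : ℝ) : ℂ))
    (G := fun N u => (gammaFactor s.re N : ℂ) * (1 - Complex.I * (u / N))⁻¹ * expFactor s N u *
      hypFactor (N - 1) (s + 1) ((2 * s.re + 2 : ℝ) : ℂ) N u)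
    (g := fun u => Complex.exp (-Complex.I * u) *
      oneF1 (s + 1) ((2 * s.re + 2 : ℝ) : ℂ) (2 * Complex.I * u))
    (fun N => by
      refine DifferentiableOn.mul (DifferentiableOn.mul ?_ (differentiableOn_expFactor s N))
        (differentiableOn_hypFactor (N - 1) _ _ N)
      refine DifferentiableOn.const_mul (DifferentiableOn.inv (by fun_prop) fun u hu => ?_) _
      exact Complex.slitPlane_ne_zero
        (one_sub_I_mul_mem_slitPlane (div_natCast_mem_halfStrip hu N)))
    (tendstoLocallyUniformlyOn_of_tendsto_prod hU fun u hu => by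
      have hinv := (((tendsto_snd_div_natCast u).const_mul Complex.I).const_sub 1).inv₀ (by simp)
      have h := (((hγ u).mul hinv).mul (tendsto_expFactor s u)).mul
        (tendsto_hypFactor (s + 1) (c := 2 * s.re + 2) (by linarith) (m := fun N => N - 1)
          (fun N => Nat.sub_le N 1) hpred hu)
      rw [Complex.ofReal_one, mul_zero, sub_zero, inv_one, one_mul, one_mul] at h
      exact h)
    (f := QN s) (φ := Qfun s) (fun N hN x hx => QN_eq s hN hx)
    (fun x hx => Qfun_eq s hx)
  refine ⟨fun N _ => ⟨?_, ?_⟩, hP1, hQ1, fun x hx p => ⟨hP2 x hx p, hQ2 x hx p⟩,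
    fun p x₀ hx₀ => ?_⟩
  · exact (contDiff_const.mul ((contDiff_sub_I_pow N N).mul (contDiff_twoF1neg N N _ _))).mul
      (contDiff_sqrt_wH s N)
  · exact (contDiff_const.mul ((contDiff_sub_I_pow (N - 1) N).mul
      (contDiff_twoF1neg (N - 1) N _ _))).mul (contDiff_sqrt_wH s N)
  · obtain ⟨C, hC⟩ := hP3 p x₀ hx₀
    obtain ⟨C', hC'⟩ := hQ3 p x₀ hx₀
    refine ⟨max C C', fun N hN x hx => ⟨(hC N hN x hx).trans ?_, ?_⟩⟩
    · gcongr
      exact le_max_left _ _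
    · have h := hC' N hN x hx
      rw [show (p : ℝ) + (s.re + 1) = (p : ℝ) + 1 + s.re by ring] at h
      refine h.trans ?_
      gcongr
      exact le_max_right _ _
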